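/- Let n ≥ 4 be an integer and, for 1 ≤ p ≤ ⌊(n−2)/2⌋, let T_p = T(p, n−p−2) be the double star on n vertices (two adjacent vertices u and v, with p further pendant vertices adjacent to u and n−p−2 further pendant vertices adjacent to v). Then 2 + √(2(n−3)/(n−2)) ≤ RE(T_p) ≤ 4 − 4/n. Moreover, the lower bound is attained if and only if p = 1, and the upper bound is attained if and only if n is even and p = (n−2)/2. -/

import Mathlib

open Polynomial

open scoped Classical in
/-- The Randić matrix of a simple graph `G`: the `(u,v)` entry is `1/√(d_u d_v)` when `uv` is
an edge and `0` otherwise, where `d_v` is the degree of the vertex `v`. -/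
noncomputable def randicMatrix {V : Type*} (G : SimpleGraph V) : Matrix V V ℝ :=
  Matrix.of fun u v =>
    if G.Adj u v then
      1 / Real.sqrt (((G.neighborSet u).ncard : ℝ) * ((G.neighborSet v).ncard : ℝ))
    else 0

lemma randicMatrix_isHermitian {V : Type*} (G : SimpleGraph V) :
    (randicMatrix G).IsHermitian := by
  ext u v
  by_cases h : G.Adj u v
  · simp [randicMatrix, Matrix.conjTranspose_apply, h, h.symm, mul_comm]
  · have h' : ¬ G.Adj v u := fun hc => h hc.symm
    simp [randicMatrix, Matrix.conjTranspose_apply, h, h']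

/-- The Randić energy of a graph: the sum of the absolute values of the eigenvalues of its
Randić matrix. -/
noncomputable def randicEnergy {V : Type*} [Fintype V] [DecidableEq V] (G : SimpleGraph V) : ℝ :=
  ∑ i, |(randicMatrix_isHermitian G).eigenvalues i|

/-- The caterpillar `T(p 0, …, p (r-1))`: a path `v_0 v_1 ⋯ v_{r-1}` (the `Sum.inl` vertices)
together with, for each `i`, `p i` pendant vertices attached to `v_i` (the `Sum.inr` vertices). -/
def caterpillar (r : ℕ) (p : Fin r → ℕ) :
    SimpleGraph ((Fin r) ⊕ (Σ i : Fin r, Fin (p i))) :=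
  SimpleGraph.fromRel (fun u v =>
    (∃ i j : Fin r, u = Sum.inl i ∧ v = Sum.inl j ∧ (i : ℕ) + 1 = (j : ℕ)) ∨
    (∃ (i : Fin r) (k : Fin (p i)), u = Sum.inl i ∧ v = Sum.inr ⟨i, k⟩))

open Matrix in
/-- The power sums of the eigenvalues of a real symmetric matrix are the traces of its powers. -/
lemma Matrix.IsHermitian.sum_eigenvalues_pow {m : Type*} [Fintype m] [DecidableEq m]
    {M : Matrix m m ℝ} (hM : M.IsHermitian) (k : ℕ) :
    ∑ i, hM.eigenvalues i ^ k = (M ^ k).trace := by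
  conv_rhs => rw [hM.spectral_theorem, ← map_pow, Unitary.conjStarAlgAut_apply, trace_mul_cycle,
    Unitary.coe_star_mul_self, one_mul, diagonal_pow]
  simp [trace]

lemma ncard_neighborSet_caterpillar_two_inl (p : Fin 2 → ℕ) (i : Fin 2) :
    ((caterpillar 2 p).neighborSet (Sum.inl i)).ncard = p i + 1 := by
  have h : (caterpillar 2 p).neighborSet (Sum.inl i) =
      insert (Sum.inl (1 - i)) (Set.range fun k : Fin (p i) => Sum.inr ⟨i, k⟩) := by
    ext (j | ⟨j, k⟩)
    · fin_cases i <;> fin_cases j <;> simp [caterpillar]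
    · simp only [caterpillar, SimpleGraph.mem_neighborSet, SimpleGraph.fromRel_adj]
      simp only [ne_eq, reduceCtorEq, not_false_eq_true, Sum.inl.injEq, Sum.inr.injEq, false_and,
        and_false, exists_false, false_or, or_false, true_and, Set.mem_insert_iff, Set.mem_range]
      constructor
      · rintro ⟨i', k', rfl, h⟩
        exact ⟨k', h.symm⟩
      · rintro ⟨k', h⟩
        exact ⟨i, k', rfl, h.symm⟩
  have hinj : Function.Injective
      fun k : Fin (p i) => (Sum.inr ⟨i, k⟩ : Fin 2 ⊕ (Σ i : Fin 2, Fin (p i))) := by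
    intro k l hkl
    simpa using hkl
  rw [h, Set.ncard_insert_of_notMem (by simp), ← Set.image_univ,
    Set.ncard_image_of_injective _ hinj, Set.ncard_univ, Nat.card_fin]

lemma caterpillar_adj_inl_inr {r : ℕ} (p : Fin r → ℕ) (i : Fin r) (x : Σ i : Fin r, Fin (p i)) :
    (caterpillar r p).Adj (Sum.inl i) (Sum.inr x) ↔ i = x.1 := by
  obtain ⟨j, k⟩ := x
  simp only [caterpillar, SimpleGraph.fromRel_adj]
  simp only [ne_eq, reduceCtorEq, not_false_eq_true, Sum.inl.injEq, Sum.inr.injEq, false_and,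
    and_false, exists_false, false_or, or_false, true_and]
  constructor
  · rintro ⟨i', k', rfl, h⟩
    exact (congrArg Sigma.fst h).symm
  · rintro rfl
    exact ⟨i, k, rfl, rfl⟩

lemma caterpillar_not_adj_inr_inr {r : ℕ} (p : Fin r → ℕ) (x y : Σ i : Fin r, Fin (p i)) :
    ¬ (caterpillar r p).Adj (Sum.inr x) (Sum.inr y) := by
  simp [caterpillar]

lemma ncard_neighborSet_caterpillar_inr {r : ℕ} (p : Fin r → ℕ) (x : Σ i : Fin r, Fin (p i)) :
    ((caterpillar r p).neighborSet (Sum.inr x)).ncard = 1 := by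
  rw [Set.ncard_eq_one]
  refine ⟨Sum.inl x.1, ?_⟩
  ext (j | y)
  · simp [SimpleGraph.adj_comm, caterpillar_adj_inl_inr]
  · simp [caterpillar_not_adj_inr_inr]

/-- The block of the Randić matrix of a double star indexed by the two centers. -/
noncomputable def doubleStarCenterBlock (p : Fin 2 → ℕ) : Matrix (Fin 2) (Fin 2) ℝ :=
  !![0, 1 / √(((p 0 : ℝ) + 1) * ((p 1 : ℝ) + 1)); 1 / √(((p 0 : ℝ) + 1) * ((p 1 : ℝ) + 1)), 0]

/-- The block of the Randić matrix of a double star with rows indexed by the centers and columns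
indexed by the pendant vertices. -/
noncomputable def doubleStarPendantBlock (p : Fin 2 → ℕ) :
    Matrix (Fin 2) (Σ i : Fin 2, Fin (p i)) ℝ :=
  Matrix.of fun i x => if i = x.1 then 1 / √((p i : ℝ) + 1) else 0

open Matrix in
lemma randicMatrix_doubleStar (p : Fin 2 → ℕ) :
    randicMatrix (caterpillar 2 p) = fromBlocks (doubleStarCenterBlock p)
      (doubleStarPendantBlock p) (doubleStarPendantBlock p)ᵀ 0 := by
  ext (i | x) (j | y)
  · simp only [randicMatrix, of_apply, ncard_neighborSet_caterpillar_two_inl, fromBlocks_apply₁₁]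
    fin_cases i <;> fin_cases j <;> simp [caterpillar, doubleStarCenterBlock, mul_comm]
  · simp [randicMatrix, ncard_neighborSet_caterpillar_two_inl, ncard_neighborSet_caterpillar_inr,
      caterpillar_adj_inl_inr, doubleStarPendantBlock]
  · simp [randicMatrix, ncard_neighborSet_caterpillar_two_inl, ncard_neighborSet_caterpillar_inr,
      SimpleGraph.adj_comm _ (Sum.inr x), caterpillar_adj_inl_inr, doubleStarPendantBlock]
  · simp [randicMatrix, caterpillar_not_adj_inr_inr]

open Matrix in
lemma doubleStarPendantBlock_mul_transpose (p : Fin 2 → ℕ) :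
    doubleStarPendantBlock p * (doubleStarPendantBlock p)ᵀ =
      !![(p 0 : ℝ) / (p 0 + 1), 0; 0, (p 1 : ℝ) / (p 1 + 1)] := by
  have h (i : Fin 2) : √((p i : ℝ) + 1) * √((p i : ℝ) + 1) = p i + 1 :=
    Real.mul_self_sqrt (by positivity)
  ext i j
  simp only [mul_apply, transpose_apply, doubleStarPendantBlock, of_apply, Fintype.sum_sigma,
    Fin.sum_univ_two]
  fin_cases i <;> fin_cases j <;> simp [← mul_inv, h, div_eq_mul_inv]

lemma Matrix.trace_fromBlocks {m k R : Type*} [Fintype m] [Fintype k] [AddCommMonoid R]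
    (A : Matrix m m R) (B : Matrix m k R) (C : Matrix k m R) (D : Matrix k k R) :
    (Matrix.fromBlocks A B C D).trace = A.trace + D.trace := by
  simp [Matrix.trace]

lemma inv_sqrt_doubleStar_sq (p : Fin 2 → ℕ) :
    (1 / √(((p 0 : ℝ) + 1) * ((p 1 : ℝ) + 1))) ^ 2 = 1 / ((p 0 + 1) * (p 1 + 1)) := by
  rw [div_pow, one_pow, Real.sq_sqrt (by positivity)]

open Matrix in
lemma trace_randicMatrix_doubleStar_sq (p : Fin 2 → ℕ) :
    (randicMatrix (caterpillar 2 p) ^ 2).trace =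
      2 + 2 * ((p 0 : ℝ) * p 1 / ((p 0 + 1) * (p 1 + 1))) := by
  have hw := inv_sqrt_doubleStar_sq p
  rw [randicMatrix_doubleStar, sq, fromBlocks_multiply, trace_fromBlocks, Matrix.mul_zero, add_zero,
    trace_mul_comm _ᵀ, doubleStarPendantBlock_mul_transpose]
  simp only [doubleStarCenterBlock, trace_fin_two, mul_fin_two, of_apply,
    cons_val', cons_val_zero, cons_val_one, cons_val_fin_one, Matrix.add_apply]
  generalize 1 / √(((p 0 : ℝ) + 1) * ((p 1 : ℝ) + 1)) = w at hw
  linear_combination 2 * hw + (by field_simp; ring :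
    2 * (1 / (((p 0 : ℝ) + 1) * (p 1 + 1))) + 2 * (p 0 / (p 0 + 1)) + 2 * (p 1 / (p 1 + 1)) =
      2 + 2 * (p 0 * p 1 / ((p 0 + 1) * (p 1 + 1))))

open Matrix in
lemma trace_randicMatrix_doubleStar_pow_four (p : Fin 2 → ℕ) :
    (randicMatrix (caterpillar 2 p) ^ 4).trace =
      2 + 2 * ((p 0 : ℝ) * p 1 / ((p 0 + 1) * (p 1 + 1))) ^ 2 := by
  have hw := inv_sqrt_doubleStar_sq p
  have hD := doubleStarPendantBlock_mul_transpose p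
  rw [randicMatrix_doubleStar, show 4 = 2 * 2 from rfl, pow_mul, sq, sq, fromBlocks_multiply,
    fromBlocks_multiply, trace_fromBlocks]
  have hmid : ((doubleStarPendantBlock p)ᵀ * doubleStarCenterBlock p *
      (doubleStarCenterBlock p * doubleStarPendantBlock p)).trace =
      (doubleStarCenterBlock p * (doubleStarPendantBlock p * (doubleStarPendantBlock p)ᵀ) *
        doubleStarCenterBlock p).trace := by
    rw [trace_mul_comm]
    simp only [Matrix.mul_assoc]
  have hlast : ((doubleStarPendantBlock p)ᵀ * doubleStarPendantBlock p *
      ((doubleStarPendantBlock p)ᵀ * doubleStarPendantBlock p)).trace =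
      (doubleStarPendantBlock p * (doubleStarPendantBlock p)ᵀ *
        (doubleStarPendantBlock p * (doubleStarPendantBlock p)ᵀ)).trace := by
    rw [Matrix.mul_assoc, trace_mul_comm]
    simp only [Matrix.mul_assoc]
  have hfirst : (doubleStarCenterBlock p * doubleStarPendantBlock p *
      ((doubleStarPendantBlock p)ᵀ * doubleStarCenterBlock p)) =
      doubleStarCenterBlock p * (doubleStarPendantBlock p * (doubleStarPendantBlock p)ᵀ) *
        doubleStarCenterBlock p := by
    simp only [Matrix.mul_assoc]
  simp only [Matrix.mul_zero, Matrix.zero_mul, add_zero, trace_add]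
  rw [hmid, hlast, hfirst, hD]
  simp only [doubleStarCenterBlock]
  generalize 1 / √(((p 0 : ℝ) + 1) * ((p 1 : ℝ) + 1)) = w at hw
  simp only [trace_fin_two, Matrix.mul_apply, Fin.sum_univ_two, of_apply, cons_val',
    cons_val_zero, cons_val_one, cons_val_fin_one, Matrix.add_apply]
  trans 2 * (w ^ 2) ^ 2 + 4 * w ^ 2 * ((p 0 : ℝ) / (p 0 + 1) + p 1 / (p 1 + 1)) +
    2 * ((p 0 : ℝ) / (p 0 + 1)) ^ 2 + 2 * ((p 1 : ℝ) / (p 1 + 1)) ^ 2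
  · ring
  · rw [hw]
    field_simp
    ring

open Matrix in
/-- Every nonzero eigenvalue `l` of the Randić matrix of a double star satisfies `l ^ 2 = 1` or
`l ^ 2 = p q / ((p + 1) (q + 1))`. -/
lemma eq_zero_or_sq_eq_of_randicMatrix_doubleStar_mulVec (p : Fin 2 → ℕ) {l : ℝ}
    {v : Fin 2 ⊕ (Σ i : Fin 2, Fin (p i)) → ℝ} (hv : v ≠ 0)
    (h : randicMatrix (caterpillar 2 p) *ᵥ v = l • v) :
    l = 0 ∨ l ^ 2 = 1 ∨ l ^ 2 = (p 0 : ℝ) * p 1 / ((p 0 + 1) * (p 1 + 1)) := by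
  rw [or_iff_not_imp_left]
  intro hl
  have hw := inv_sqrt_doubleStar_sq p
  rw [randicMatrix_doubleStar, fromBlocks_mulVec, zero_mulVec, add_zero] at h
  have hc : doubleStarCenterBlock p *ᵥ (v ∘ Sum.inl) +
      doubleStarPendantBlock p *ᵥ (v ∘ Sum.inr) = l • (v ∘ Sum.inl) :=
    funext fun i => congrFun h (Sum.inl i)
  have hr : (doubleStarPendantBlock p)ᵀ *ᵥ (v ∘ Sum.inl) = l • (v ∘ Sum.inr) :=
    funext fun x => congrFun h (Sum.inr x)
  have hl0 : v ∘ Sum.inl ≠ 0 := by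
    intro h0
    rw [h0, mulVec_zero, eq_comm, smul_eq_zero_iff_right hl] at hr
    exact hv (funext fun i => i.rec (congrFun h0) (congrFun hr))
  have hred : l • (doubleStarCenterBlock p *ᵥ (v ∘ Sum.inl)) +
      !![(p 0 : ℝ) / (p 0 + 1), 0; 0, (p 1 : ℝ) / (p 1 + 1)] *ᵥ (v ∘ Sum.inl) =
        l ^ 2 • (v ∘ Sum.inl) := by
    rw [← doubleStarPendantBlock_mul_transpose, ← mulVec_mulVec, hr, mulVec_smul, ← smul_add, hc,
      smul_smul, sq]
  generalize v ∘ Sum.inl = y at *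
  have e0 := congrFun hred 0
  have e1 := congrFun hred 1
  simp only [doubleStarCenterBlock, Pi.add_apply, Pi.smul_apply, smul_eq_mul,
    mulVec, dotProduct, Fin.sum_univ_two, of_apply, cons_val', cons_val_zero, cons_val_one,
    cons_val_fin_one] at e0 e1
  generalize 1 / √(((p 0 : ℝ) + 1) * ((p 1 : ℝ) + 1)) = w at hw e0 e1
  simp only [zero_mul, zero_add, add_zero] at e0 e1
  have hdet : (l ^ 2 - p 0 / (p 0 + 1)) * (l ^ 2 - p 1 / (p 1 + 1)) = l ^ 2 * w ^ 2 := by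
    by_cases hy : y 0 = 0
    · have hy1 : y 1 ≠ 0 := fun hy1 => hl0 (by ext i; fin_cases i <;> simp [hy, hy1])
      apply mul_right_cancel₀ hy1
      linear_combination (-(l ^ 2 - p 0 / (p 0 + 1))) * e1 - l * w * e0
    · apply mul_right_cancel₀ hy
      linear_combination (-(l ^ 2 - p 1 / (p 1 + 1))) * e0 - l * w * e1
  rw [hw] at hdet
  rw [← sub_eq_zero, ← sub_eq_zero (a := l ^ 2) (b := _ / _), ← mul_eq_zero]
  field_simp at hdet ⊢
  linear_combination hdet

theorem randicEnergy_doubleStar (p : Fin 2 → ℕ) (h0 : 1 ≤ p 0) (h1 : 1 ≤ p 1) :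
    randicEnergy (caterpillar 2 p) =
      2 + 2 * √((p 0 : ℝ) * p 1 / ((p 0 + 1) * (p 1 + 1))) := by
  have hM := randicMatrix_isHermitian (caterpillar 2 p)
  have h2 := hM.sum_eigenvalues_pow 2
  have h4 := hM.sum_eigenvalues_pow 4
  rw [trace_randicMatrix_doubleStar_sq] at h2
  rw [trace_randicMatrix_doubleStar_pow_four] at h4
  have hmem (i) := eq_zero_or_sq_eq_of_randicMatrix_doubleStar_mulVec p
    (fun h => hM.eigenvectorBasis.orthonormal.ne_zero i (by ext j; exact congrFun h j))
    (hM.mulVec_eigenvectorBasis i)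
  have hs0 : 0 < (p 0 : ℝ) * p 1 / ((p 0 + 1) * (p 1 + 1)) := by positivity
  have hs1 : (p 0 : ℝ) * p 1 / ((p 0 + 1) * (p 1 + 1)) < 1 := by
    rw [div_lt_one (by positivity)]
    nlinarith
  generalize (p 0 : ℝ) * p 1 / ((p 0 + 1) * (p 1 + 1)) = s at *
  obtain ⟨t, ht0, rfl⟩ : ∃ t, 0 < t ∧ s = t ^ 2 :=
    ⟨√s, Real.sqrt_pos.2 hs0, (Real.sq_sqrt hs0.le).symm⟩
  rw [Real.sqrt_sq ht0.le]
  have ht1 : t < 1 := by nlinarith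
  -- Interpolate `|x|` on the spectrum by an even polynomial of degree four.
  have habs (i) : t * (1 + t) * |hM.eigenvalues i| =
      (1 + t + t ^ 2) * hM.eigenvalues i ^ 2 - hM.eigenvalues i ^ 4 := by
    rw [← sq_abs (hM.eigenvalues i), show hM.eigenvalues i ^ 4 = |hM.eigenvalues i| ^ 4 by
      rw [← abs_pow, abs_of_nonneg (by positivity)]]
    rcases hmem i with h | h | h
    · simp [h]
    · rw [(pow_eq_one_iff_of_nonneg (abs_nonneg _) two_ne_zero).1 ((sq_abs _).trans h)]
      ring
    · rw [(pow_left_inj₀ (abs_nonneg _) ht0.le two_ne_zero).1 ((sq_abs _).trans h)]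
      ring
  have hsum : t * (1 + t) * randicEnergy (caterpillar 2 p) = t * (1 + t) * (2 + 2 * t) := by
    rw [randicEnergy, Finset.mul_sum, Finset.sum_congr rfl fun i _ => habs i,
      Finset.sum_sub_distrib, ← Finset.mul_sum, h2, h4]
    ring
  exact mul_left_cancel₀ (by positivity) hsum

/-- For `n ≥ 4` and `1 ≤ p ≤ ⌊(n-2)/2⌋`, the Randić energy of the double star
`T_p = T(p, n-p-2)` satisfies `2 + √(2(n-3)/(n-2)) ≤ RE(T_p) ≤ 4 - 4/n`; the lower bound is
attained iff `p = 1` and the upper bound is attained iff `n` is even and `p = (n-2)/2`. -/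
theorem doubleStar_randicEnergy_bounds (n : ℕ) (hn : 4 ≤ n) :
    ∀ p : ℕ, 1 ≤ p → p ≤ (n - 2) / 2 →
      (2 + Real.sqrt (2 * ((n : ℝ) - 3) / ((n : ℝ) - 2))
          ≤ randicEnergy (caterpillar 2 ![p, n - p - 2]) ∧
        randicEnergy (caterpillar 2 ![p, n - p - 2]) ≤ 4 - 4 / (n : ℝ)) ∧
      (randicEnergy (caterpillar 2 ![p, n - p - 2])
          = 2 + Real.sqrt (2 * ((n : ℝ) - 3) / ((n : ℝ) - 2)) ↔ p = 1) ∧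
      (randicEnergy (caterpillar 2 ![p, n - p - 2]) = 4 - 4 / (n : ℝ) ↔
        Even n ∧ 2 * p = n - 2) := by
  intro p hp hpn
  obtain ⟨q, rfl⟩ : ∃ q, n = p + q + 2 := ⟨n - p - 2, by omega⟩
  have hpq : p ≤ q := by omega
  rw [show p + q + 2 - p - 2 = q by omega, randicEnergy_doubleStar _ (by simpa) (by simp; omega)]
  have hev : Even (p + q + 2) ∧ 2 * p = p + q + 2 - 2 ↔ p = q :=
    ⟨fun h => by omega, fun h => ⟨⟨p + 1, by omega⟩, by omega⟩⟩
  rw [hev]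
  simp only [Matrix.cons_val_zero, Matrix.cons_val_one, Matrix.cons_val_fin_one]
  push_cast
  rw [← Nat.cast_inj (R := ℝ) (n := 1), ← Nat.cast_inj (R := ℝ) (n := q), Nat.cast_one]
  have hp' : (1 : ℝ) ≤ p := by exact_mod_cast hp
  have hpq' : (p : ℝ) ≤ q := by exact_mod_cast hpq
  generalize (p : ℝ) = a at *
  generalize (q : ℝ) = b at *
  have hb : 1 ≤ b := hp'.trans hpq'
  have hlow : a * b / ((a + 1) * (b + 1)) - (a + b - 1) / (2 * (a + b)) =
      (a + b + 1) * ((a - 1) * (b - 1)) / (2 * (a + b) * ((a + 1) * (b + 1))) := by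
    field_simp
    ring
  have hupp : ((a + b) / (a + b + 2)) ^ 2 - a * b / ((a + 1) * (b + 1)) =
      (a + b + 1) * (b - a) ^ 2 / ((a + b + 2) ^ 2 * ((a + 1) * (b + 1))) := by
    field_simp
    ring
  have hlow0 : 0 ≤ (a + b - 1) / (2 * (a + b)) := div_nonneg (by linarith) (by linarith)
  have hR : 0 ≤ a * b / ((a + 1) * (b + 1)) := by positivity
  have hL : √(2 * (a + b + 2 - 3) / (a + b + 2 - 2)) = 2 * √((a + b - 1) / (2 * (a + b))) := by
    rw [show 2 * (a + b + 2 - 3) / (a + b + 2 - 2) = 2 ^ 2 * ((a + b - 1) / (2 * (a + b))) by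
      rw [show a + b + 2 - 2 = a + b by ring]
      field_simp
      ring, Real.sqrt_mul (by norm_num), Real.sqrt_sq (by norm_num)]
  have hU : 4 - 4 / (a + b + 2) = 2 + 2 * √(((a + b) / (a + b + 2)) ^ 2) := by
    rw [Real.sqrt_sq (by positivity)]
    field_simp
    ring
  rw [hL, hU]
  simp only [add_le_add_iff_left, add_right_inj, mul_le_mul_iff_right₀ (two_pos : (0 : ℝ) < 2),
    mul_right_inj' (two_ne_zero : (2 : ℝ) ≠ 0)]
  rw [Real.sqrt_inj hR hlow0, Real.sqrt_inj hR (by positivity)]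
  refine ⟨⟨Real.sqrt_le_sqrt ?_, Real.sqrt_le_sqrt ?_⟩, ?_, ?_⟩
  · rw [← sub_nonneg, hlow]
    have := mul_nonneg (sub_nonneg.2 hp') (sub_nonneg.2 hb)
    positivity
  · rw [← sub_nonneg, hupp]
    positivity
  · have hd : 2 * (a + b) * ((a + 1) * (b + 1)) ≠ 0 := by positivity
    have hs : a + b + 1 ≠ 0 := by positivity
    rw [← sub_eq_zero, hlow, div_eq_zero_iff, or_iff_left hd, mul_eq_zero, or_iff_right hs,
      mul_eq_zero]
    constructor
    · rintro (h | h) <;> linarith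
    · intro h
      left
      linarith
  · have hd : (a + b + 2) ^ 2 * ((a + 1) * (b + 1)) ≠ 0 := by positivity
    have hs : a + b + 1 ≠ 0 := by positivity
    rw [eq_comm, ← sub_eq_zero, hupp, div_eq_zero_iff, or_iff_left hd, mul_eq_zero,
      or_iff_right hs, sq_eq_zero_iff, sub_eq_zero, eq_comm]
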